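/- Let S ⊆ {(x₁, x₂, y₁) ∈ ℝ³ : x₁ < 0} and S' ⊆ {(x₁, x₂, y₁) ∈ ℝ³ : x₁ > 0} both be negative slices. Then there exist a compactly supported area-preserving diffeomorphism φ of ℝ², a flat-at-infinity planar Lagrangian N, and c < 0 such that N is transverse to {y₂ = c} and N ∩ {y₂ = c} = i_c((φ × id)(S ∪ S')). (Proposition: the sum of two slices is again a slice.) -/

import Mathlib

noncomputable section

/-- ℝ⁴ with coordinates (x₁, x₂, y₁, y₂). -/
abbrev R4 := ℝ × ℝ × ℝ × ℝ
/-- ℝ² with coordinates (x₁, y₁). -/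
abbrev R2 := ℝ × ℝ
/-- ℝ³ with coordinates (x₁, x₂, y₁). -/
abbrev R3 := ℝ × ℝ × ℝ

/-- The standard symplectic form ω(u,v) = u₁v₃ − u₃v₁ + u₂v₄ − u₄v₂ on ℝ⁴. -/
def omega4 (u v : R4) : ℝ :=
  u.1 * v.2.2.1 - u.2.2.1 * v.1 + u.2.1 * v.2.2.2 - u.2.2.2 * v.2.1

/-- A symplectomorphism of ℝ⁴. -/
def IsSymplectomorphism (ψ : R4 → R4) : Prop :=
  Function.Bijective ψ ∧ ContDiff ℝ (⊤ : ℕ∞) ψ ∧ ContDiff ℝ (⊤ : ℕ∞) (Function.invFun ψ) ∧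
  ∀ p u v : R4, omega4 (fderiv ℝ ψ p u) (fderiv ℝ ψ p v) = omega4 u v

/-- The Hamiltonian vector field of H : ℝ⁴ → ℝ, coordinates (x₁, x₂, y₁, y₂). -/
def HamVF (H : R4 → ℝ) (p : R4) : R4 :=
  (fderiv ℝ H p (0, 0, 1, 0), fderiv ℝ H p (0, 0, 0, 1),
   -fderiv ℝ H p (1, 0, 0, 0), -fderiv ℝ H p (0, 1, 0, 0))

/-- A global Hamiltonian flow of H on ℝ⁴. -/
def IsHamFlow (H : R4 → ℝ) (Φ : ℝ × R4 → R4) : Prop :=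
  ContDiff ℝ (⊤ : ℕ∞) Φ ∧ (∀ p, Φ (0, p) = p) ∧
  ∀ (t : ℝ) (p : R4), HasDerivAt (fun s => Φ (s, p)) (HamVF H (Φ (t, p))) t

/-- A parametrization of a flat-at-infinity planar Lagrangian. -/
def IsFlatParam (f : R2 → R4) : Prop :=
  ContDiff ℝ (⊤ : ℕ∞) f ∧ Function.Injective f ∧ IsProperMap f ∧
  (∀ p : R2, Function.Injective (fderiv ℝ f p)) ∧
  (∀ (p : R2) (u v : R2), omega4 (fderiv ℝ f p u) (fderiv ℝ f p v) = 0) ∧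
  ∃ K : Set R2, IsCompact K ∧ ∀ p : R2, p ∉ K → f p = (p.1, p.2, 0, 0)

/-- A flat-at-infinity planar Lagrangian. -/
def IsFlatLagrangian (L : Set R4) : Prop :=
  ∃ f : R2 → R4, IsFlatParam f ∧ Set.range f = L

/-- `L` is transverse to the hyperplane {y₂ = a}. -/
def TransverseAt (L : Set R4) (a : ℝ) : Prop :=
  ∃ f : R2 → R4, IsFlatParam f ∧ Set.range f = L ∧
    ∀ p : R2, (f p).2.2.2 = a → fderiv ℝ (fun q => (f q).2.2.2) p ≠ 0

/-- An area-preserving diffeomorphism of ℝ². -/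
def IsAreaDiffeo (φ : R2 → R2) : Prop :=
  Function.Bijective φ ∧ ContDiff ℝ (⊤ : ℕ∞) φ ∧ ContDiff ℝ (⊤ : ℕ∞) (Function.invFun φ) ∧
  ∀ p : R2, LinearMap.det ((fderiv ℝ φ p) : R2 →ₗ[ℝ] R2) = 1

/-- φ equals the identity outside a compact set. -/
def IsCompactSupported (φ : R2 → R2) : Prop :=
  ∃ K : Set R2, IsCompact K ∧ ∀ p : R2, p ∉ K → φ p = p

/-- φ × id : ℝ³ → ℝ³. -/
def phiTimesId (φ : R2 → R2) (p : R3) : R3 :=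
  ((φ (p.1, p.2.2)).1, p.2.1, (φ (p.1, p.2.2)).2)

/-- The inclusion i_a : ℝ³ → ℝ⁴. -/
def iMap (a : ℝ) (p : R3) : R4 := (p.1, p.2.1, p.2.2, a)

/-- S ◁ S' : strict Lagrange cobordism relation. -/
def SliceRelStrict (S S' : Set R3) : Prop :=
  ∃ (L : Set R4) (a b : ℝ), a < b ∧ b < 0 ∧ IsFlatLagrangian L ∧
    TransverseAt L a ∧ TransverseAt L b ∧
    L ∩ {p : R4 | p.2.2.2 = a} = iMap a '' S ∧
    L ∩ {p : R4 | p.2.2.2 = b} = iMap b '' S'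

/-- S ⊴ S' : non-strict Lagrange cobordism relation. -/
def SliceRel (S S' : Set R3) : Prop :=
  ∃ (L : Set R4) (a b : ℝ), a ≤ b ∧ b < 0 ∧ IsFlatLagrangian L ∧
    TransverseAt L a ∧ TransverseAt L b ∧
    L ∩ {p : R4 | p.2.2.2 = a} = iMap a '' S ∧
    L ∩ {p : R4 | p.2.2.2 = b} = iMap b '' S'

/-- S ∼ S' : equivalence of slices. -/
def SliceEquiv (S S' : Set R3) : Prop :=
  ∃ φ : R2 → R2, IsAreaDiffeo φ ∧ IsCompactSupported φ ∧ phiTimesId φ '' S = S'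

/-- A negative slice. -/
def IsNegativeSlice (S : Set R3) : Prop :=
  ∃ (L : Set R4) (a : ℝ), a < 0 ∧ IsFlatLagrangian L ∧ TransverseAt L a ∧
    L ∩ {p : R4 | p.2.2.2 = a} = iMap a '' S
/-- Time-dependent Hamiltonian vector field on ℝ⁴. -/
def HamVF4t (H : ℝ × R4 → ℝ) (t : ℝ) (p : R4) : R4 :=
  (fderiv ℝ (fun q => H (t, q)) p (0, 0, 1, 0),
   fderiv ℝ (fun q => H (t, q)) p (0, 0, 0, 1),
   -fderiv ℝ (fun q => H (t, q)) p (1, 0, 0, 0),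
   -fderiv ℝ (fun q => H (t, q)) p (0, 1, 0, 0))

/-- A global Hamiltonian flow of a time-dependent Hamiltonian on ℝ⁴. -/
def IsHamFlow4t (H : ℝ × R4 → ℝ) (Φ : ℝ × R4 → R4) : Prop :=
  ContDiff ℝ (⊤ : ℕ∞) Φ ∧ (∀ p, Φ (0, p) = p) ∧
  ∀ (t : ℝ) (p : R4), HasDerivAt (fun s => Φ (s, p)) (HamVF4t H t (Φ (t, p))) t

/-- Time-dependent Hamiltonian vector field on ℝ², coordinates (x₁, y₁). -/
def HamVF2t (H : ℝ × R2 → ℝ) (t : ℝ) (q : R2) : R2 :=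
  (fderiv ℝ (fun r => H (t, r)) q (0, 1), -fderiv ℝ (fun r => H (t, r)) q (1, 0))

/-- A global Hamiltonian flow of a time-dependent Hamiltonian on ℝ². -/
def IsHamFlow2t (H : ℝ × R2 → ℝ) (φ : ℝ × R2 → R2) : Prop :=
  ContDiff ℝ (⊤ : ℕ∞) φ ∧ (∀ q, φ (0, q) = q) ∧
  ∀ (t : ℝ) (q : R2), HasDerivAt (fun s => φ (s, q)) (HamVF2t H t (φ (t, q))) t

/-- Translation of ℝ⁴ by s in the x₁-direction. -/
def trX1 (s : ℝ) (p : R4) : R4 := (p.1 + s, p.2.1, p.2.2.1, p.2.2.2)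

/-- Φ_φ : ℝ⁴ → ℝ⁴ induced by an area-preserving diffeomorphism φ of the x₁y₁-plane. -/
def PhiPhi (φ : R2 → R2) (p : R4) : R4 :=
  ((φ (p.1, p.2.2.1)).1, p.2.1, (φ (p.1, p.2.2.1)).2, p.2.2.2)

/-! ### Area-preserving twists -/

lemma isAreaDiffeo_of_inverse {φ ψ : R2 → R2} (h1 : Function.LeftInverse ψ φ)
    (h2 : Function.RightInverse ψ φ) (c1 : ContDiff ℝ (⊤ : ℕ∞) φ) (c2 : ContDiff ℝ (⊤ : ℕ∞) ψ)
    (hd : ∀ p : R2, LinearMap.det ((fderiv ℝ φ p) : R2 →ₗ[ℝ] R2) = 1) : IsAreaDiffeo φ := by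
  refine ⟨⟨h1.injective, h2.surjective⟩, c1, ?_, hd⟩
  have : Function.invFun φ = ψ := by
    funext x
    apply h1.injective
    rw [Function.invFun_eq ⟨ψ x, h2 x⟩, h2 x]
  rw [this]; exact c2

lemma IsAreaDiffeo.comp' {φ ψ : R2 → R2} (hφ : IsAreaDiffeo φ) (hψ : IsAreaDiffeo ψ) :
    IsAreaDiffeo (φ ∘ ψ) := by
  obtain ⟨b1, c1, i1, d1⟩ := hφ
  obtain ⟨b2, c2, i2, d2⟩ := hψ
  refine isAreaDiffeo_of_inverse (ψ := Function.invFun ψ ∘ Function.invFun φ) ?_ ?_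
    (c1.comp c2) (i2.comp i1) ?_
  · exact (Function.leftInverse_invFun b1.1).comp (Function.leftInverse_invFun b2.1)
  · exact (Function.rightInverse_invFun b1.2).comp (Function.rightInverse_invFun b2.2)
  · intro p
    have e1 : DifferentiableAt ℝ φ (ψ p) := c1.differentiable (by simp) _
    have e2 : DifferentiableAt ℝ ψ p := c2.differentiable (by simp) _
    rw [fderiv_comp p e1 e2]
    have : (((fderiv ℝ φ (ψ p)).comp (fderiv ℝ ψ p) : R2 →L[ℝ] R2) : R2 →ₗ[ℝ] R2)
      = ((fderiv ℝ φ (ψ p)) : R2 →ₗ[ℝ] R2) ∘ₗ ((fderiv ℝ ψ p) : R2 →ₗ[ℝ] R2) := rfl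
    rw [this, LinearMap.det_comp, d1, d2, one_mul]

/-- rotation about `(k, 0)` by an angle depending on the squared distance -/
def twist (A : ℝ → ℝ) (k : ℝ) (p : R2) : R2 :=
  (k + (Real.cos (A ((p.1 - k) ^ 2 + p.2 ^ 2)) * (p.1 - k)
      - Real.sin (A ((p.1 - k) ^ 2 + p.2 ^ 2)) * p.2),
   Real.sin (A ((p.1 - k) ^ 2 + p.2 ^ 2)) * (p.1 - k)
      + Real.cos (A ((p.1 - k) ^ 2 + p.2 ^ 2)) * p.2)

lemma twist_radius (A : ℝ → ℝ) (k : ℝ) (p : R2) :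
    ((twist A k p).1 - k) ^ 2 + (twist A k p).2 ^ 2 = (p.1 - k) ^ 2 + p.2 ^ 2 := by
  simp only [twist]
  have := Real.sin_sq_add_cos_sq (A ((p.1 - k) ^ 2 + p.2 ^ 2))
  linear_combination ((p.1 - k) ^ 2 + p.2 ^ 2) * this

lemma twist_neg (A : ℝ → ℝ) (k : ℝ) (p : R2) :
    twist (fun u => - A u) k (twist A k p) = p := by
  have hr := twist_radius A k p
  have := Real.sin_sq_add_cos_sq (A ((p.1 - k) ^ 2 + p.2 ^ 2))
  rw [twist]
  simp only [hr, Real.cos_neg, Real.sin_neg]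
  simp only [twist]
  ext
  · simp only
    linear_combination (p.1 - k) * this
  · simp only
    linear_combination (p.2) * this

lemma twist_contDiff (A : ℝ → ℝ) (hA : ContDiff ℝ (⊤ : ℕ∞) A) (k : ℝ) :
    ContDiff ℝ (⊤ : ℕ∞) (twist A k) := by
  unfold twist
  fun_prop

lemma det_R2 (T : R2 →ₗ[ℝ] R2) :
    LinearMap.det T = (T (1, 0)).1 * (T (0, 1)).2 - (T (0, 1)).1 * (T (1, 0)).2 := by
  rw [← LinearMap.det_toMatrix (Module.Basis.finTwoProd ℝ), Matrix.det_fin_two]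
  simp [LinearMap.toMatrix_apply]

lemma twist_det (A : ℝ → ℝ) (hA : ContDiff ℝ (⊤ : ℕ∞) A) (k : ℝ) (p : R2) :
    LinearMap.det ((fderiv ℝ (twist A k) p) : R2 →ₗ[ℝ] R2) = 1 := by
  have hf : HasFDerivAt (Prod.fst : R2 → ℝ) (ContinuousLinearMap.fst ℝ ℝ ℝ) p := hasFDerivAt_fst
  have hs : HasFDerivAt (Prod.snd : R2 → ℝ) (ContinuousLinearMap.snd ℝ ℝ ℝ) p := hasFDerivAt_snd
  have hX := hf.sub_const k
  have hr := (hX.pow 2).add (hs.pow 2)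
  have hAd : HasDerivAt A (deriv A ((p.1 - k) ^ 2 + p.2 ^ 2)) ((p.1 - k) ^ 2 + p.2 ^ 2) :=
    (hA.differentiable (by simp) _).hasDerivAt
  have hAr := hAd.comp_hasFDerivAt p hr
  have hc := hAr.cos
  have hsn := hAr.sin
  have h1 := ((hc.mul hX).sub (hsn.mul hs)).const_add k
  have h2 := (hsn.mul hX).add (hc.mul hs)
  have h := h1.prodMk h2
  have hfd := HasFDerivAt.fderiv (f := twist A k) h
  rw [hfd, det_R2]
  have := Real.sin_sq_add_cos_sq (A ((p.1 - k) ^ 2 + p.2 ^ 2))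
  simp
  linear_combination this

lemma twist_isAreaDiffeo (A : ℝ → ℝ) (hA : ContDiff ℝ (⊤ : ℕ∞) A) (k : ℝ) :
    IsAreaDiffeo (twist A k) := by
  refine isAreaDiffeo_of_inverse (ψ := twist (fun u => - A u) k) (twist_neg A k) ?_
    (twist_contDiff A hA k) (twist_contDiff _ hA.neg k) (twist_det A hA k)
  intro p
  simpa using twist_neg (fun u => - A u) k p

lemma twist_outside (A : ℝ → ℝ) (k : ℝ) (p : R2) (h : A ((p.1 - k) ^ 2 + p.2 ^ 2) = 0) :
    twist A k p = p := by
  simp [twist, h]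

lemma twist_inside (A : ℝ → ℝ) (k : ℝ) (p : R2) (h : A ((p.1 - k) ^ 2 + p.2 ^ 2) = Real.pi) :
    twist A k p = (2 * k - p.1, - p.2) := by
  simp [twist, h]; ring

/-- The angle function -/
def angleFn (R e u : ℝ) : ℝ := Real.pi * Real.smoothTransition ((R ^ 2 - u) / e)

lemma angleFn_contDiff (R e : ℝ) : ContDiff ℝ (⊤ : ℕ∞) (angleFn R e) := by
  unfold angleFn
  have : ContDiff ℝ (⊤ : ℕ∞) Real.smoothTransition := Real.smoothTransition.contDiff
  exact contDiff_const.mul (this.comp (by fun_prop))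

lemma angleFn_in {R e u : ℝ} (he : 0 < e) (h : u ≤ R ^ 2 - e) : angleFn R e u = Real.pi := by
  unfold angleFn
  rw [Real.smoothTransition.one_of_one_le, mul_one]
  rw [le_div_iff₀ he]; linarith

lemma angleFn_out {R e u : ℝ} (he : 0 < e) (h : R ^ 2 ≤ u) : angleFn R e u = 0 := by
  unfold angleFn
  rw [Real.smoothTransition.zero_of_nonpos, mul_zero]
  exact div_nonpos_of_nonpos_of_nonneg (by linarith) he.le

lemma twist_compact (R e k : ℝ) (he : 0 < e) :
    IsCompactSupported (twist (angleFn R e) k) := by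
  refine ⟨Set.Icc (k - |R|) (k + |R|) ×ˢ Set.Icc (-|R|) |R|, isCompact_Icc.prod isCompact_Icc, ?_⟩
  intro p hp
  apply twist_outside
  apply angleFn_out he
  by_contra hlt
  push Not at hlt
  apply hp
  have h1 : |p.1 - k| ≤ |R| := sq_le_sq.1 (by nlinarith [sq_nonneg p.2])
  have h2 : |p.2| ≤ |R| := sq_le_sq.1 (by nlinarith [sq_nonneg (p.1 - k)])
  rw [abs_le] at h1 h2
  exact ⟨⟨by linarith, by linarith⟩, ⟨by linarith, by linarith⟩⟩

lemma IsCompactSupported.comp' {φ ψ : R2 → R2} (hφ : IsCompactSupported φ)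
    (hψ : IsCompactSupported ψ) : IsCompactSupported (φ ∘ ψ) := by
  obtain ⟨K, hK, h⟩ := hφ
  obtain ⟨K', hK', h'⟩ := hψ
  refine ⟨K ∪ K', hK.union hK', fun p hp => ?_⟩
  have h1 : p ∉ K := fun q => hp (Or.inl q)
  have h2 : p ∉ K' := fun q => hp (Or.inr q)
  simp [h' p h2, h p h1]

/-! ### Flat parametrizations -/

lemma flat_proper {f : R2 → R4} (hf : Continuous f) {K : Set R2} (hK : IsCompact K)
    (h : ∀ p : R2, p ∉ K → f p = (p.1, p.2, 0, 0)) : IsProperMap f := by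
  rw [isProperMap_iff_tendsto_cocompact]
  refine ⟨hf, ?_⟩
  have hc : Topology.IsClosedEmbedding (fun p : R2 => ((p.1, p.2, 0, 0) : R4)) := by
    apply Topology.IsClosedEmbedding.of_continuous_injective_isClosedMap
    · fun_prop
    · intro p q h
      simp only [Prod.mk.injEq] at h
      exact Prod.ext h.1 h.2.1
    · intro s hs
      have : (fun p : R2 => ((p.1, p.2, 0, 0) : R4)) '' s
          = {q : R4 | q.2.2 = 0} ∩ (fun q : R4 => ((q.1, q.2.1) : R2)) ⁻¹' s := by
        ext q
        constructor
        · rintro ⟨p, hp, rfl⟩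
          exact ⟨rfl, hp⟩
        · rintro ⟨h1, h2⟩
          refine ⟨_, h2, ?_⟩
          simp only [Set.mem_setOf_eq] at h1
          exact Prod.ext rfl (Prod.ext rfl h1.symm)
      rw [this]
      exact (isClosed_eq (by fun_prop) continuous_const).inter (hs.preimage (by fun_prop))
  refine hc.tendsto_cocompact.congr' ?_
  filter_upwards [hK.compl_mem_cocompact] with p hp
  exact (h p hp).symm

/-- bundled data: flat parametrization with slice `S` at level `c`. -/
def Good (f : R2 → R4) (c : ℝ) (S : Set R3) : Prop :=
  IsFlatParam f ∧ (∀ p : R2, (f p).2.2.2 = c → fderiv ℝ (fun q => (f q).2.2.2) p ≠ 0) ∧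
  Set.range f ∩ {p : R4 | p.2.2.2 = c} = iMap c '' S

/-- half-turn in R3 -/
def half (t : ℝ) (p : R3) : R3 := (t - p.1, p.2.1, - p.2.2)

/-- derivative of the level reparametrization -/
def gd (k a y : ℝ) : ℝ := 1 + k * (y * (y - a)) ^ 2

def gg (k a y : ℝ) : ℝ := y + k * (y ^ 5 / 5 - a * y ^ 4 / 2 + a ^ 2 * y ^ 3 / 3)

lemma gd_pos {k : ℝ} (hk : 0 ≤ k) (a y : ℝ) : 0 < gd k a y := by
  unfold gd; positivity

lemma gg_hasDerivAt (k a y : ℝ) : HasDerivAt (gg k a) (gd k a y) y := by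
  have h5 := ((hasDerivAt_id y).pow 5).div_const 5
  have h4 := (((hasDerivAt_id y).pow 4).const_mul a).div_const 2
  have h3 := (((hasDerivAt_id y).pow 3).const_mul (a ^ 2)).div_const 3
  have h := (hasDerivAt_id y).add (((h5.sub h4).add h3).const_mul k)
  refine HasDerivAt.congr_deriv (f := gg k a) h ?_
  simp only [gd, id]; push_cast; ring

lemma gg_inj {k : ℝ} (hk : 0 ≤ k) (a : ℝ) : Function.Injective (gg k a) := by
  apply StrictMono.injective
  apply strictMono_of_deriv_pos
  intro y
  rw [(gg_hasDerivAt k a y).deriv]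
  exact gd_pos hk a y

def psi (t k a : ℝ) (q : R4) : R4 :=
  (t - q.1, q.2.1 * (gd k a q.2.2.2)⁻¹, - q.2.2.1, gg k a q.2.2.2)

def sig (t : ℝ) (p : R2) : R2 := (t - p.1, p.2)

lemma psi_contDiff (t : ℝ) {k : ℝ} (hk : 0 ≤ k) (a : ℝ) : ContDiff ℝ (⊤ : ℕ∞) (psi t k a) := by
  have h : ContDiff ℝ (⊤ : ℕ∞) (fun q : R4 => gd k a q.2.2.2) := by unfold gd; fun_prop
  have h' := h.inv (fun q => (gd_pos hk a q.2.2.2).ne')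
  have h2 : ContDiff ℝ (⊤ : ℕ∞) (fun q : R4 => gg k a q.2.2.2) := by unfold gg; fun_prop
  have h3 : ContDiff ℝ (⊤ : ℕ∞) (fun q : R4 => q.2.1) := by fun_prop
  have h4 : ContDiff ℝ (⊤ : ℕ∞) (fun q : R4 => t - q.1) := by fun_prop
  have h5 : ContDiff ℝ (⊤ : ℕ∞) (fun q : R4 => - q.2.2.1) := by fun_prop
  exact h4.prodMk ((h3.mul h').prodMk (h5.prodMk h2))

lemma psi_inj (t : ℝ) {k : ℝ} (hk : 0 ≤ k) (a : ℝ) : Function.Injective (psi t k a) := by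
  rintro ⟨x, y, z, w⟩ ⟨x', y', z', w'⟩ h
  simp only [psi, Prod.mk.injEq] at h
  obtain ⟨h1, h2, h3, h4⟩ := h
  have := gg_inj hk a h4
  subst this
  have h2' := mul_right_cancel₀ (inv_ne_zero (gd_pos hk a w).ne') h2
  simp only [Prod.mk.injEq]
  exact ⟨by linarith, h2', by linarith, trivial⟩

lemma psi_omega (t : ℝ) {k : ℝ} (hk : 0 ≤ k) (a : ℝ) (q u v : R4) :
    omega4 (fderiv ℝ (psi t k a) q u) (fderiv ℝ (psi t k a) q v) = omega4 u v := by
  have h0 := gd_pos hk a q.2.2.2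
  have h1 : HasFDerivAt (fun q : R4 => q.1) (ContinuousLinearMap.fst ℝ ℝ (ℝ × ℝ × ℝ)) q :=
    hasFDerivAt_fst
  have hB : HasFDerivAt (fun q : R4 => q.2) (ContinuousLinearMap.snd ℝ ℝ (ℝ × ℝ × ℝ)) q :=
    hasFDerivAt_snd
  have h2 : HasFDerivAt (fun q : R4 => q.2.1) _ q := hB.fst
  have hC : HasFDerivAt (fun q : R4 => q.2.2) _ q := hB.snd
  have h3 : HasFDerivAt (fun q : R4 => q.2.2.1) _ q := hC.fst
  have h4 : HasFDerivAt (fun q : R4 => q.2.2.2) _ q := hC.snd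
  have hg := (gg_hasDerivAt k a q.2.2.2).comp_hasFDerivAt q h4
  obtain ⟨d, hd⟩ : ∃ d, HasDerivAt (fun y => (gd k a y)⁻¹) d q.2.2.2 := by
    have : DifferentiableAt ℝ (gd k a) q.2.2.2 := by unfold gd; fun_prop
    exact ⟨_, (this.inv h0.ne').hasDerivAt⟩
  have hdi := hd.comp_hasFDerivAt q h4
  have h := (h1.const_sub t).prodMk ((h2.mul hdi).prodMk (h3.neg.prodMk hg))
  have hfd := HasFDerivAt.fderiv (f := psi t k a) h
  rw [hfd]
  simp [omega4]
  field_simp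
  ring

lemma omega4_nondeg {u : R4} (h : ∀ v, omega4 u v = 0) : u = 0 := by
  have a1 := h (0, 0, 1, 0)
  have a2 := h (0, 0, 0, 1)
  have a3 := h (1, 0, 0, 0)
  have a4 := h (0, 1, 0, 0)
  simp [omega4] at a1 a2 a3 a4
  ext <;> simp [*]

lemma psi_fderiv_inj (t : ℝ) {k : ℝ} (hk : 0 ≤ k) (a : ℝ) (q : R4) :
    Function.Injective (fderiv ℝ (psi t k a) q) := by
  rw [injective_iff_map_eq_zero]
  intro u hu
  apply omega4_nondeg
  intro v
  rw [← psi_omega t hk a q u v, hu]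
  simp [omega4]

lemma sig_sig (t : ℝ) (p : R2) : sig t (sig t p) = p := by simp [sig]

lemma sig_contDiff (t : ℝ) : ContDiff ℝ (⊤ : ℕ∞) (sig t) := by unfold sig; fun_prop

lemma sig_fderiv (t : ℝ) (p v : R2) :
    fderiv ℝ (sig t) (sig t p) (fderiv ℝ (sig t) p v) = v := by
  have hd := (sig_contDiff t).differentiable (by simp)
  have h : fderiv ℝ (sig t ∘ sig t) p = ContinuousLinearMap.id ℝ R2 := by
    have : sig t ∘ sig t = id := funext (sig_sig t)
    rw [this, fderiv_id]
  rw [fderiv_comp p (hd _) (hd _)] at h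
  have := congrArg (fun T : R2 →L[ℝ] R2 => T v) h
  simpa using this

lemma prep {f : R2 → R4} {a c t k : ℝ} {S : Set R3} (h : Good f a S) (hk : 0 ≤ k)
    (hc : gg k a a = c) : Good (fun p => psi t k a (f (sig t p))) c (half t '' S) := by
  obtain ⟨⟨cf, inj, -, dinj, om, K, hK, flat⟩, tr, sl⟩ := h
  have dψ : Differentiable ℝ (psi t k a) := (psi_contDiff t hk a).differentiable (by simp)
  have df : Differentiable ℝ f := cf.differentiable (by simp)
  have dσ : Differentiable ℝ (sig t) := (sig_contDiff t).differentiable (by simp)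
  have cF : ContDiff ℝ (⊤ : ℕ∞) (fun p => psi t k a (f (sig t p))) :=
    (psi_contDiff t hk a).comp (cf.comp (sig_contDiff t))
  have hfd : ∀ p u, fderiv ℝ (fun p => psi t k a (f (sig t p))) p u
      = fderiv ℝ (psi t k a) (f (sig t p)) (fderiv ℝ f (sig t p) (fderiv ℝ (sig t) p u)) := by
    intro p u
    have := ((dψ (f (sig t p))).hasFDerivAt.comp p
      ((df (sig t p)).hasFDerivAt.comp p (dσ p).hasFDerivAt)).fderiv
    have h2 := congrArg (fun T : R2 →L[ℝ] R4 => T u) this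
    exact h2
  have flat' : ∀ p : R2, p ∉ sig t '' K → psi t k a (f (sig t p)) = (p.1, p.2, 0, 0) := by
    intro p hp
    have : sig t p ∉ K := fun hq => hp ⟨_, hq, sig_sig t p⟩
    rw [flat _ this]
    simp [psi, sig, gd, gg]
  have hK' : IsCompact (sig t '' K) := hK.image (sig_contDiff t).continuous
  refine ⟨⟨cF, ?_, flat_proper cF.continuous hK' flat', ?_, ?_, _, hK', flat'⟩, ?_, ?_⟩
  · intro p q hpq
    have := inj (psi_inj t hk a hpq)
    rw [← sig_sig t p, this, sig_sig]
  · intro p u v huv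
    rw [hfd, hfd] at huv
    have := dinj _ (psi_fderiv_inj t hk a _ huv)
    rw [← sig_fderiv t p u, this, sig_fderiv]
  · intro p u v
    rw [hfd, hfd, psi_omega t hk, om]
  · intro p hp h0
    have hy : (f (sig t p)).2.2.2 = a := gg_inj hk a (hp.trans hc.symm)
    apply tr _ hy
    have dy : DifferentiableAt ℝ (fun q => (f q).2.2.2) (sig t p) := by fun_prop
    have h1 := (gg_hasDerivAt k a ((f (sig t p)).2.2.2)).comp_hasFDerivAt p
      (dy.hasFDerivAt.comp p (dσ p).hasFDerivAt)
    have h2 := h1.fderiv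
    have h3 : fderiv ℝ (fun q => (psi t k a (f (sig t q))).2.2.2) p = _ := h2
    rw [h0] at h3
    ext1
    all_goals
      ext
      simp only [ContinuousLinearMap.comp_apply, ContinuousLinearMap.zero_apply]
    · have h4 := congrArg (fun T : R2 →L[ℝ] ℝ => T (fderiv ℝ (sig t) (sig t p) (1, 0))) h3
      have h5 := sig_fderiv t (sig t p) (1, 0)
      rw [sig_sig] at h5
      simp [h5, (gd_pos hk a _).ne'] at h4
      simpa using h4
    · have h4 := congrArg (fun T : R2 →L[ℝ] ℝ => T (fderiv ℝ (sig t) (sig t p) (0, 1))) h3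
      have h5 := sig_fderiv t (sig t p) (0, 1)
      rw [sig_sig] at h5
      simp [h5, (gd_pos hk a _).ne'] at h4
      simpa using h4
  · have hga : gd k a a = 1 := by simp [gd]
    ext q
    constructor
    · rintro ⟨⟨p, rfl⟩, hp⟩
      have hy : (f (sig t p)).2.2.2 = a := gg_inj hk a (Eq.trans hp hc.symm)
      have hm : f (sig t p) ∈ iMap a '' S := by rw [← sl]; exact ⟨⟨_, rfl⟩, hy⟩
      obtain ⟨s, hs, hsf⟩ := hm
      refine ⟨half t s, ⟨s, hs, rfl⟩, ?_⟩
      simp only [← hsf]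
      simp [iMap, half, psi, hga, hc]
    · rintro ⟨_, ⟨s, hs, rfl⟩, rfl⟩
      have hm : iMap a s ∈ iMap a '' S := ⟨s, hs, rfl⟩
      rw [← sl] at hm
      obtain ⟨⟨p, hp⟩, -⟩ := hm
      refine ⟨⟨sig t p, ?_⟩, rfl⟩
      simp only [sig_sig, hp]
      simp [iMap, half, psi, hga, hc]

lemma glue {f f' : R2 → R4} {c : ℝ} {S S' : Set R3} (hc : c ≠ 0) (h : Good f c S)
    (h' : Good f' c S')
    (fl : ∀ p : R2, -1 < p.1 → f p = (p.1, p.2, 0, 0)) (fn : ∀ p : R2, p.1 < 0 → (f p).1 < 0)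
    (fl' : ∀ p : R2, p.1 < 1 → f' p = (p.1, p.2, 0, 0))
    (fn' : ∀ p : R2, 0 < p.1 → 0 < (f' p).1) :
    ∃ F, Good F c (S ∪ S') := by
  obtain ⟨⟨cf, inj, -, dinj, om, K, hK, flat⟩, tr, sl⟩ := h
  obtain ⟨⟨cf', inj', -, dinj', om', K', hK', flat'⟩, tr', sl'⟩ := h'
  obtain ⟨F, hF, hF'⟩ : ∃ F : R2 → R4, (∀ p : R2, p.1 < 1 → F p = f p) ∧
      (∀ p : R2, -1 < p.1 → F p = f' p) := by
    refine ⟨fun p => if p.1 ≤ 0 then f p else f' p, ?_, ?_⟩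
    · intro p hp
      by_cases h0 : p.1 ≤ 0
      · simp [h0]
      · simp only [h0, if_false]
        rw [fl' p hp, fl p (by linarith)]
    · intro p hp
      by_cases h0 : p.1 ≤ 0
      · simp only [h0, if_true]
        rw [fl' p (by linarith), fl p hp]
      · simp [h0]
  have eF : ∀ p : R2, p.1 < 1 → F =ᶠ[nhds p] f := by
    intro p hp
    filter_upwards [(isOpen_lt continuous_fst continuous_const).mem_nhds hp] with q hq
    exact hF q hq
  have eF' : ∀ p : R2, -1 < p.1 → F =ᶠ[nhds p] f' := by
    intro p hp
    filter_upwards [(isOpen_lt continuous_const continuous_fst).mem_nhds hp] with q hq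
    exact hF' q hq
  have cases1 : ∀ p : R2, p.1 < 1 ∨ -1 < p.1 := by
    intro p
    rcases lt_or_ge p.1 1 with h | h
    · exact Or.inl h
    · right; linarith
  have cF : ContDiff ℝ (⊤ : ℕ∞) F := by
    rw [contDiff_iff_contDiffAt]
    intro p
    rcases cases1 p with hp | hp
    · exact (cf.contDiffAt).congr_of_eventuallyEq (eF p hp)
    · exact (cf'.contDiffAt).congr_of_eventuallyEq (eF' p hp)
  have flatF : ∀ p : R2, p ∉ K ∪ K' → F p = (p.1, p.2, 0, 0) := by
    intro p hp
    rcases cases1 p with h1 | h1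
    · rw [hF p h1, flat p (fun q => hp (Or.inl q))]
    · rw [hF' p h1, flat' p (fun q => hp (Or.inr q))]
  have hKK := hK.union hK'
  refine ⟨F, ⟨cF, ?_, flat_proper cF.continuous hKK flatF, ?_, ?_, _, hKK, flatF⟩, ?_, ?_⟩
  · have key : ∀ p q : R2, p.1 ≤ -1 → 1 ≤ q.1 → F p ≠ F q := by
      intro p q hp hq he
      rw [hF p (by linarith), hF' q (by linarith)] at he
      have h1 := fn p (by linarith)
      have h2 := fn' q (by linarith)
      rw [he] at h1
      linarith
    intro p q hpq
    by_cases hp : p.1 < 1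
    · by_cases hq : q.1 < 1
      · rw [hF p hp, hF q hq] at hpq
        exact inj hpq
      · by_cases hp2 : -1 < p.1
        · rw [hF' p hp2, hF' q (by linarith)] at hpq
          exact inj' hpq
        · exact absurd hpq (key p q (by linarith) (by linarith))
    · by_cases hq2 : -1 < q.1
      · rw [hF' p (by linarith), hF' q hq2] at hpq
        exact inj' hpq
      · exact absurd hpq.symm (key q p (by linarith) (by linarith))
  · intro p
    rcases cases1 p with hp | hp
    · rw [(eF p hp).fderiv_eq]; exact dinj p
    · rw [(eF' p hp).fderiv_eq]; exact dinj' p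
  · intro p u v
    rcases cases1 p with hp | hp
    · rw [(eF p hp).fderiv_eq]; exact om p u v
    · rw [(eF' p hp).fderiv_eq]; exact om' p u v
  · intro p hy
    rcases cases1 p with hp | hp
    · have e : (fun q => (F q).2.2.2) =ᶠ[nhds p] (fun q => (f q).2.2.2) :=
        (eF p hp).fun_comp (fun r : R4 => r.2.2.2)
      rw [e.fderiv_eq]
      exact tr p (by rw [← hF p hp]; exact hy)
    · have e : (fun q => (F q).2.2.2) =ᶠ[nhds p] (fun q => (f' q).2.2.2) :=
        (eF' p hp).fun_comp (fun r : R4 => r.2.2.2)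
      rw [e.fderiv_eq]
      exact tr' p (by rw [← hF' p hp]; exact hy)
  · rw [Set.image_union, ← sl, ← sl']
    ext q
    constructor
    · rintro ⟨⟨p, rfl⟩, hp⟩
      rcases cases1 p with h1 | h1
      · left
        rw [hF p h1] at hp ⊢
        exact ⟨⟨p, rfl⟩, hp⟩
      · right
        rw [hF' p h1] at hp ⊢
        exact ⟨⟨p, rfl⟩, hp⟩
    · rintro (⟨⟨p, rfl⟩, hp⟩ | ⟨⟨p, rfl⟩, hp⟩)
      · have h1 : p.1 < 1 := by
          by_contra hn
          rw [fl p (by linarith)] at hp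
          exact hc hp.symm
        rw [← hF p h1] at hp ⊢
        exact ⟨⟨p, rfl⟩, hp⟩
      · have h1 : -1 < p.1 := by
          by_contra hn
          rw [fl' p (by linarith)] at hp
          exact hc hp.symm
        rw [← hF' p h1] at hp ⊢
        exact ⟨⟨p, rfl⟩, hp⟩

lemma flat_bound {f : R2 → R4} (h : IsFlatParam f) : ∃ M : ℝ, 0 < M ∧
    (∀ p : R2, M < |p.1| → f p = (p.1, p.2, 0, 0)) ∧ ∀ p : R2, |(f p).1 - p.1| ≤ M := by
  obtain ⟨cf, -, -, -, -, K, hK, flat⟩ := h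
  obtain ⟨A, hA⟩ := hK.exists_bound_of_continuousOn (f := fun p : R2 => p.1)
    (by fun_prop)
  have := cf.continuous
  obtain ⟨B, hB⟩ := hK.exists_bound_of_continuousOn (f := fun p : R2 => (f p).1 - p.1)
    (by fun_prop)
  refine ⟨|A| + |B| + 1, by positivity, ?_, ?_⟩
  · intro p hp
    apply flat
    intro hpK
    have h1 := hA p hpK
    rw [Real.norm_eq_abs] at h1
    linarith [le_abs_self A, abs_nonneg B]
  · intro p
    by_cases hpK : p ∈ K
    · have h1 := hB p hpK
      rw [Real.norm_eq_abs] at h1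
      linarith [le_abs_self B, abs_nonneg A]
    · rw [flat p hpK]
      simp
      positivity

lemma slice_compact {f : R2 → R4} {a : ℝ} {S : Set R3} (ha : a ≠ 0) (h : Good f a S) :
    IsCompact S := by
  obtain ⟨⟨cf, -, -, -, -, K, hK, flat⟩, -, sl⟩ := h
  have hc : IsCompact (f '' K ∩ {p : R4 | p.2.2.2 = a}) :=
    (hK.image cf.continuous).inter_right (isClosed_eq (by fun_prop) continuous_const)
  have he : S = (fun q : R4 => ((q.1, q.2.1, q.2.2.1) : R3)) '' 
      (f '' K ∩ {p : R4 | p.2.2.2 = a}) := by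
    ext s
    constructor
    · intro hs
      have hm : iMap a s ∈ iMap a '' S := ⟨s, hs, rfl⟩
      rw [← sl] at hm
      obtain ⟨⟨p, hp⟩, h2⟩ := hm
      refine ⟨iMap a s, ⟨⟨p, ?_, hp⟩, h2⟩, rfl⟩
      by_contra hpK
      rw [flat p hpK] at hp
      have := congrArg (fun q : R4 => q.2.2.2) hp
      exact ha this.symm
    · rintro ⟨q, ⟨⟨p, hp, rfl⟩, h2⟩, rfl⟩
      have hm : f p ∈ iMap a '' S := by rw [← sl]; exact ⟨⟨p, rfl⟩, h2⟩
      obtain ⟨s, hs, hsp⟩ := hm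
      rw [← hsp]
      exact hs
  rw [he]
  exact hc.image (by fun_prop)

/-- compact subsets of an open half space lie in large discs -/
lemma disc_bound {S : Set R3} (hS : IsCompact S) (e : ℝ) (hp : ∀ s ∈ S, 0 < e * s.1) :
    ∃ d M : ℝ, 0 < d ∧ 0 ≤ M ∧ (∀ s ∈ S, d ≤ e * s.1) ∧ ∀ s ∈ S, s.1 ^ 2 + s.2.2 ^ 2 ≤ M := by
  obtain ⟨d, hd, h1⟩ := hS.exists_forall_le' (f := fun s : R3 => e * s.1) (by fun_prop) hp
  obtain ⟨B, hB⟩ := hS.exists_bound_of_continuousOn (f := fun s : R3 => s.1 ^ 2 + s.2.2 ^ 2)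
    (by fun_prop)
  refine ⟨d, |B|, hd, abs_nonneg _, h1, fun s hs => ?_⟩
  exact (le_abs_self _).trans ((hB s hs).trans (le_abs_self B))

lemma level {a c : ℝ} (ha : a < 0) (hc : c ≤ a) : ∃ k : ℝ, 0 ≤ k ∧ gg k a a = c := by
  have h5 : a ^ 5 < 0 := Odd.pow_neg (by decide) ha
  refine ⟨(c - a) * 30 / a ^ 5, div_nonneg_of_nonpos (by linarith) h5.le, ?_⟩
  unfold gg
  have := ha.ne
  field_simp
  ring

lemma exists_good {S : Set R3} (h : IsNegativeSlice S) : ∃ f a, a < 0 ∧ Good f a S := by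
  obtain ⟨L, a, ha, -, ⟨f, hf, rfl, tr⟩, sl⟩ := h
  exact ⟨f, a, ha, hf, tr, sl⟩

/-- The sum of two negative slices is again a negative slice (up to equivalence). -/
theorem sum_is_slice (S S' : Set R3)
    (hS : S ⊆ {p : R3 | p.1 < 0}) (hS' : S' ⊆ {p : R3 | p.1 > 0})
    (hSn : IsNegativeSlice S) (hS'n : IsNegativeSlice S') :
    ∃ (φ : R2 → R2) (N : Set R4) (c : ℝ),
      IsAreaDiffeo φ ∧ IsCompactSupported φ ∧ c < 0 ∧
      IsFlatLagrangian N ∧ TransverseAt N c ∧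
      N ∩ {p : R4 | p.2.2.2 = c} = iMap c '' (phiTimesId φ '' (S ∪ S')) := by
  obtain ⟨f, a, ha, hf⟩ := exists_good hSn
  obtain ⟨f', a', ha', hf'⟩ := exists_good hS'n
  obtain ⟨M, hM, flat, disp⟩ := flat_bound hf.1
  obtain ⟨M', hM', flat', disp'⟩ := flat_bound hf'.1
  obtain ⟨d, B, hd, hB0, hdS, hBS⟩ := disc_bound (slice_compact ha.ne hf) (-1)
    (fun s hs => by have := hS hs; simp only [Set.mem_setOf_eq] at this; linarith)
  obtain ⟨d', B', hd', hB0', hdS', hBS'⟩ := disc_bound (slice_compact ha'.ne hf') 1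
    (fun s hs => by have := hS' hs; simp only [Set.mem_setOf_eq] at this; linarith)
  obtain ⟨k, hk, hkc⟩ := level ha (min_le_left a a')
  obtain ⟨k', hk', hkc'⟩ := level ha' (min_le_right a a')
  have hc : min a a' < 0 := lt_of_le_of_lt (min_le_left _ _) ha
  obtain ⟨R, hR⟩ : ∃ R : ℝ, R = M + M' + 1 + B / d + B' / d' := ⟨_, rfl⟩
  have hBd : 0 ≤ B / d := by positivity
  have hBd' : 0 ≤ B' / d' := by positivity
  have hRM : M + M' + 1 ≤ R := by linarith
  have hR0 : 0 < R := by linarith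
  have hRB : B ≤ R * d := by rw [← div_le_iff₀ hd]; linarith
  have hRB' : B' ≤ R * d' := by rw [← div_le_iff₀ hd']; linarith
  have G := prep (t := 2 * (-R)) hf hk hkc
  have G' := prep (t := 2 * R) hf' hk' hkc'
  obtain ⟨F, hF⟩ := glue hc.ne G G'
    (by
      intro p hp
      have : M < |(sig (2 * (-R)) p).1| := by
        rw [lt_abs]; right; simp only [sig]; linarith
      simp only [flat _ this]
      simp [psi, sig, gd, gg])
    (by
      intro p hp
      have h1 := disp (sig (2 * (-R)) p)
      by_cases hq : M < |(sig (2 * (-R)) p).1|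
      · simp only [flat _ hq]
        simpa [psi, sig] using hp
      · simp only [psi]
        rw [not_lt] at hq
        rw [abs_le] at h1 hq
        linarith [h1.1, hq.1])
    (by
      intro p hp
      have : M' < |(sig (2 * R) p).1| := by
        rw [lt_abs]; left; simp only [sig]; linarith
      simp only [flat' _ this]
      simp [psi, sig, gd, gg])
    (by
      intro p hp
      have h1 := disp' (sig (2 * R) p)
      by_cases hq : M' < |(sig (2 * R) p).1|
      · simp only [flat' _ hq]
        simpa [psi, sig] using hp
      · simp only [psi]
        rw [not_lt] at hq
        rw [abs_le] at h1 hq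
        linarith [h1.2, hq.2])
  have he : 0 < R * d := by positivity
  have he' : 0 < R * d' := by positivity
  -- the two half-turns
  have t1 : ∀ s ∈ S, twist (angleFn R (R * d)) (-R) (s.1, s.2.2) = (2 * (-R) - s.1, - s.2.2) := by
    intro s hs
    apply twist_inside
    apply angleFn_in he
    have h1 := hdS s hs
    have h2 := hBS s hs
    simp only
    nlinarith
  have t2 : ∀ s ∈ S', twist (angleFn R (R * d')) R (s.1, s.2.2) = (2 * R - s.1, - s.2.2) := by
    intro s hs
    apply twist_inside
    apply angleFn_in he'
    have h1 := hdS' s hs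
    have h2 := hBS' s hs
    simp only
    nlinarith
  have o1 : ∀ p : R2, 0 ≤ p.1 → twist (angleFn R (R * d)) (-R) p = p := by
    intro p hp
    apply twist_outside
    apply angleFn_out he
    nlinarith [sq_nonneg p.1, sq_nonneg p.2, mul_nonneg hR0.le hp]
  have o2 : ∀ p : R2, p.1 ≤ 0 → twist (angleFn R (R * d')) R p = p := by
    intro p hp
    apply twist_outside
    apply angleFn_out he'
    nlinarith [sq_nonneg p.1, sq_nonneg p.2, mul_nonneg hR0.le (neg_nonneg.2 hp)]
  -- the rotated right slice stays in the right half plane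
  have t2pos : ∀ s ∈ S', 0 ≤ 2 * R - s.1 := by
    intro s hs
    have h1 := hdS' s hs
    have h2 := hBS' s hs
    by_contra hn
    push Not at hn
    nlinarith [sq_nonneg s.2.2]
  refine ⟨twist (angleFn R (R * d)) (-R) ∘ twist (angleFn R (R * d')) R, Set.range F, min a a',
    (twist_isAreaDiffeo _ (angleFn_contDiff _ _) _).comp'
      (twist_isAreaDiffeo _ (angleFn_contDiff _ _) _),
    (twist_compact _ _ _ he).comp' (twist_compact _ _ _ he'), hc, ⟨F, hF.1, rfl⟩,
    ⟨F, hF.1, rfl, hF.2.1⟩, ?_⟩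
  rw [hF.2.2, Set.image_union (phiTimesId _)]
  congr 2
  · apply Set.image_congr
    intro s hs
    have : s.1 < 0 := hS hs
    simp only [phiTimesId, Function.comp, o2 (s.1, s.2.2) this.le, t1 s hs, half]
  · apply Set.image_congr
    intro s hs
    simp only [phiTimesId, Function.comp, t2 s hs, o1 (2 * R - s.1, - s.2.2) (t2pos s hs), half]
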